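/- For every v ∈ F_{C_1}: if v(p) = t_0^1 then v(¬(p ∧ ¬p)) = F_1. Moreover, there exists v ∈ F_{C_1} with v(p) = t_0^1. Consequently, the principle of non-contradiction ¬(p ∧ ¬p) is not a tautology of R(M_{C_1}). -/

import Mathlib

/-- Formulas of the language of da Costa's calculi `Cₙ`. -/
inductive CnForm : Type where
  | atom : ℕ → CnForm
  | neg : CnForm → CnForm
  | conj : CnForm → CnForm → CnForm
  | disj : CnForm → CnForm → CnForm
  | imp : CnForm → CnForm → CnForm
deriving DecidableEq

/-- Truth values of the Nmatrix `M_{Cₙ}`: `Tv` is `Tₙ`, `tv i` is `tᵢⁿ`, `Fv` is `Fₙ`. -/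
inductive CnVal (n : ℕ) : Type where
  | Tv : CnVal n
  | tv : Fin n → CnVal n
  | Fv : CnVal n
deriving DecidableEq

/-- Multifunction for negation. -/
def CnNeg {n : ℕ} : CnVal n → Set (CnVal n)
  | CnVal.Tv => {CnVal.Fv}
  | CnVal.tv _ => {x | x ≠ CnVal.Fv}
  | CnVal.Fv => {CnVal.Tv}

/-- Multifunction for conjunction. -/
def CnConj {n : ℕ} (x y : CnVal n) : Set (CnVal n) :=
  if x = CnVal.Fv ∨ y = CnVal.Fv then {CnVal.Fv}
  else if x = CnVal.Tv ∧ y = CnVal.Tv then {CnVal.Tv}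
  else {z | z ≠ CnVal.Fv}

/-- Multifunction for disjunction. -/
def CnDisj {n : ℕ} (x y : CnVal n) : Set (CnVal n) :=
  if x = CnVal.Fv ∧ y = CnVal.Fv then {CnVal.Fv}
  else if (x = CnVal.Tv ∨ x = CnVal.Fv) ∧ (y = CnVal.Tv ∨ y = CnVal.Fv) ∧
          (x = CnVal.Tv ∨ y = CnVal.Tv) then {CnVal.Tv}
  else {z | z ≠ CnVal.Fv}

/-- Multifunction for implication. -/
def CnImp {n : ℕ} (x y : CnVal n) : Set (CnVal n) :=
  if x ≠ CnVal.Fv ∧ y = CnVal.Fv then {CnVal.Fv}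
  else if (x = CnVal.Fv ∧ (y = CnVal.Tv ∨ y = CnVal.Fv)) ∨ (x = CnVal.Tv ∧ y = CnVal.Tv)
    then {CnVal.Tv}
  else {z | z ≠ CnVal.Fv}

/-- `v ∈ Val(M_{Cₙ})`: `v` is a valuation of the Nmatrix `M_{Cₙ}`. -/
def CnIsVal {n : ℕ} (v : CnForm → CnVal n) : Prop :=
  (∀ a, v (CnForm.neg a) ∈ CnNeg (v a)) ∧
  (∀ a b, v (CnForm.conj a b) ∈ CnConj (v a) (v b)) ∧
  (∀ a b, v (CnForm.disj a b) ∈ CnDisj (v a) (v b)) ∧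
  (∀ a b, v (CnForm.imp a b) ∈ CnImp (v a) (v b))

/-- `a.pow k` is `αᵏ`: `α⁰ = α`, `α^{k+1} = ¬(αᵏ ∧ ¬αᵏ)`. -/
def CnForm.pow (a : CnForm) : ℕ → CnForm
  | 0 => a
  | k + 1 => CnForm.neg (CnForm.conj (a.pow k) (CnForm.neg (a.pow k)))

/-- `v ∈ F_{Cₙ}`: a valuation satisfying the restriction of the RNmatrix for `Cₙ`. -/
def CnRestricted {n : ℕ} (v : CnForm → CnVal n) : Prop :=
  CnIsVal v ∧
  ∀ (a : CnForm) (i : Fin n), v a = CnVal.tv i →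
    (i.val = 0 → v (CnForm.conj a (CnForm.neg a)) = CnVal.Tv) ∧
    (∀ j : Fin n, i.val = j.val + 1 →
      (∃ m : Fin n, v (CnForm.conj a (CnForm.neg a)) = CnVal.tv m) ∧
      v (a.pow 1) = CnVal.tv j)

/-- Tautology of the RNmatrix `R(M_{Cₙ}) = ⟨F_{Cₙ}, M_{Cₙ}⟩`. -/
def CnTaut (n : ℕ) (φ : CnForm) : Prop :=
  ∀ v : CnForm → CnVal n, CnRestricted v → v φ ≠ CnVal.Fv

/-- The valuation sending every atom to `t₀` and evaluating each connective in the classical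
values `Tₙ`, `Fₙ`, according to which of the arguments are designated. -/
def CnForm.classicalExtension : CnForm → CnVal 1
  | .atom _ => .tv 0
  | .neg a => if a.classicalExtension = .Tv then .Fv else .Tv
  | .conj a b =>
    if a.classicalExtension = .Fv ∨ b.classicalExtension = .Fv then .Fv else .Tv
  | .disj a b =>
    if a.classicalExtension = .Fv ∧ b.classicalExtension = .Fv then .Fv else .Tv
  | .imp a b =>
    if a.classicalExtension ≠ .Fv ∧ b.classicalExtension = .Fv then .Fv else .Tv

theorem CnForm.isVal_classicalExtension : CnIsVal CnForm.classicalExtension := by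
  refine ⟨fun a => ?_, fun a b => ?_, fun a b => ?_, fun a b => ?_⟩
  · rw [CnForm.classicalExtension]
    cases a.classicalExtension <;> simp [CnNeg]
  all_goals
    rw [CnForm.classicalExtension]
    cases a.classicalExtension <;> cases b.classicalExtension <;>
      simp [CnConj, CnDisj, CnImp]

theorem CnForm.restricted_classicalExtension : CnRestricted CnForm.classicalExtension := by
  refine ⟨CnForm.isVal_classicalExtension, fun a i h => ⟨fun _ => ?_, fun j hj => ?_⟩⟩
  · simp [CnForm.classicalExtension, h]
  · omega

/-- If `α` has value `t₀`, then `¬(α ∧ ¬α)` has value `Fₙ`. -/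
theorem CnRestricted.non_contradiction_eq_Fv {n : ℕ} {v : CnForm → CnVal n}
    (hv : CnRestricted v) {a : CnForm} {i : Fin n} (hi : i.val = 0) (ha : v a = CnVal.tv i) :
    v (CnForm.neg (CnForm.conj a (CnForm.neg a))) = CnVal.Fv := by
  have h := hv.1.1 (CnForm.conj a (CnForm.neg a))
  rw [(hv.2 a i ha).1 hi] at h
  exact h

theorem non_contradiction_fails_in_restricted_C1 (p : ℕ) :
    (∀ v : CnForm → CnVal 1, CnRestricted v → v (CnForm.atom p) = CnVal.tv 0 →
      v (CnForm.neg (CnForm.conj (CnForm.atom p) (CnForm.neg (CnForm.atom p)))) = CnVal.Fv) ∧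
    (∃ v : CnForm → CnVal 1, CnRestricted v ∧ v (CnForm.atom p) = CnVal.tv 0) ∧
    ¬ CnTaut 1 (CnForm.neg (CnForm.conj (CnForm.atom p) (CnForm.neg (CnForm.atom p)))) := by
  have hp : (CnForm.atom p).classicalExtension = CnVal.tv 0 := rfl
  have hv := CnForm.restricted_classicalExtension
  exact ⟨fun v hv h => hv.non_contradiction_eq_Fv rfl h, ⟨_, hv, hp⟩,
    fun taut => taut _ hv (hv.non_contradiction_eq_Fv rfl hp)⟩
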